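/- arXiv:2507.00470 — 5 statements merged into one kernel-verified Lean document; each statement's English description precedes it below -/
import Mathlib

section
/- For every matrix Z in V = span_ℝ{J₁,…,J₇} and every vector Y ∈ ℝ⁸ there exists a matrix B ∈ N = span_ℝ{[Jᵢ,Jⱼ] : 1 ≤ i < j ≤ 7} such that [B, Z] = 0 and B·Y = Z·Y. (This is the strong transitive normalizer condition for V; it is the algebraic content of the statement that the 15-dimensional pseudo H-type nilmanifold N_{3,4} is a geodesic orbit pseudo-Riemannian manifold.) -/
open Matrix

noncomputable section

/-- The Clifford map `J_{Z₁}` of the pseudo H-type Lie algebra `n_{3,4}`. -/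
def J1 : Matrix (Fin 8) (Fin 8) ℝ :=
  !![0,-1,0,0,0,0,0,0;
     1,0,0,0,0,0,0,0;
     0,0,0,1,0,0,0,0;
     0,0,-1,0,0,0,0,0;
     0,0,0,0,0,0,0,1;
     0,0,0,0,0,0,1,0;
     0,0,0,0,0,-1,0,0;
     0,0,0,0,-1,0,0,0]

/-- The Clifford map `J_{Z₂}`. -/
def J2 : Matrix (Fin 8) (Fin 8) ℝ :=
  !![0,0,-1,0,0,0,0,0;
     0,0,0,-1,0,0,0,0;
     1,0,0,0,0,0,0,0;
     0,1,0,0,0,0,0,0;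
     0,0,0,0,0,0,1,0;
     0,0,0,0,0,0,0,-1;
     0,0,0,0,-1,0,0,0;
     0,0,0,0,0,1,0,0]

/-- The Clifford map `J_{Z₃}`. -/
def J3 : Matrix (Fin 8) (Fin 8) ℝ :=
  !![0,0,0,-1,0,0,0,0;
     0,0,1,0,0,0,0,0;
     0,-1,0,0,0,0,0,0;
     1,0,0,0,0,0,0,0;
     0,0,0,0,0,1,0,0;
     0,0,0,0,-1,0,0,0;
     0,0,0,0,0,0,0,1;
     0,0,0,0,0,0,-1,0]

/-- The Clifford map `J_{Z₄}`. -/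
def J4 : Matrix (Fin 8) (Fin 8) ℝ :=
  !![0,0,0,0,1,0,0,0;
     0,0,0,0,0,0,0,1;
     0,0,0,0,0,0,1,0;
     0,0,0,0,0,1,0,0;
     1,0,0,0,0,0,0,0;
     0,0,0,1,0,0,0,0;
     0,0,1,0,0,0,0,0;
     0,1,0,0,0,0,0,0]

/-- The Clifford map `J_{Z₅}`. -/
def J5 : Matrix (Fin 8) (Fin 8) ℝ :=
  !![0,0,0,0,0,1,0,0;
     0,0,0,0,0,0,1,0;
     0,0,0,0,0,0,0,-1;
     0,0,0,0,-1,0,0,0;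
     0,0,0,-1,0,0,0,0;
     1,0,0,0,0,0,0,0;
     0,1,0,0,0,0,0,0;
     0,0,-1,0,0,0,0,0]

/-- The Clifford map `J_{Z₆}`. -/
def J6 : Matrix (Fin 8) (Fin 8) ℝ :=
  !![0,0,0,0,0,0,1,0;
     0,0,0,0,0,-1,0,0;
     0,0,0,0,-1,0,0,0;
     0,0,0,0,0,0,0,1;
     0,0,-1,0,0,0,0,0;
     0,-1,0,0,0,0,0,0;
     1,0,0,0,0,0,0,0;
     0,0,0,1,0,0,0,0]

/-- The Clifford map `J_{Z₇}`. -/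
def J7 : Matrix (Fin 8) (Fin 8) ℝ :=
  !![0,0,0,0,0,0,0,1;
     0,0,0,0,-1,0,0,0;
     0,0,0,0,0,1,0,0;
     0,0,0,0,0,0,-1,0;
     0,-1,0,0,0,0,0,0;
     0,0,1,0,0,0,0,0;
     0,0,0,-1,0,0,0,0;
     1,0,0,0,0,0,0,0]

/-- The family `J₁, …, J₇`. -/
def J : Fin 7 → Matrix (Fin 8) (Fin 8) ℝ := ![J1, J2, J3, J4, J5, J6, J7]

/-- `N = span ℝ {[Jᵢ, Jⱼ] : 1 ≤ i < j ≤ 7}`, the normalizer of `V = span {J₁,…,J₇}`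
in `so(4,4)`. -/
def NN : Submodule ℝ (Matrix (Fin 8) (Fin 8) ℝ) :=
  Submodule.span ℝ {M | ∃ i j : Fin 7, i < j ∧ M = J i * J j - J j * J i}

/-- Explicit action of `∑ pᵢ Jᵢ`. -/
def act (p : Fin 7 → ℝ) (y : Fin 8 → ℝ) : Fin 8 → ℝ :=
  ![- p 0 * y 1 - p 1 * y 2 - p 2 * y 3 + p 3 * y 4 + p 4 * y 5 + p 5 * y 6 + p 6 * y 7,
    p 0 * y 0 - p 1 * y 3 + p 2 * y 2 + p 3 * y 7 + p 4 * y 6 - p 5 * y 5 - p 6 * y 4,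
    p 0 * y 3 + p 1 * y 0 - p 2 * y 1 + p 3 * y 6 - p 4 * y 7 - p 5 * y 4 + p 6 * y 5,
    - p 0 * y 2 + p 1 * y 1 + p 2 * y 0 + p 3 * y 5 - p 4 * y 4 + p 5 * y 7 - p 6 * y 6,
    p 0 * y 7 + p 1 * y 6 + p 2 * y 5 + p 3 * y 0 - p 4 * y 3 - p 5 * y 2 - p 6 * y 1,
    p 0 * y 6 - p 1 * y 7 - p 2 * y 4 + p 3 * y 3 + p 4 * y 0 - p 5 * y 1 + p 6 * y 2,
    - p 0 * y 5 - p 1 * y 4 + p 2 * y 7 + p 3 * y 2 + p 4 * y 1 + p 5 * y 0 - p 6 * y 3,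
    - p 0 * y 4 + p 1 * y 5 - p 2 * y 6 + p 3 * y 1 - p 4 * y 2 + p 5 * y 3 + p 6 * y 0]

def Jv (p : Fin 7 → ℝ) : Matrix (Fin 8) (Fin 8) ℝ := ∑ i, p i • J i

def ip (p q : Fin 7 → ℝ) : ℝ :=
  p 0 * q 0 + p 1 * q 1 + p 2 * q 2 - p 3 * q 3 - p 4 * q 4 - p 5 * q 5 - p 6 * q 6

def gg (x y : Fin 8 → ℝ) : ℝ :=
  x 0 * y 0 + x 1 * y 1 + x 2 * y 2 + x 3 * y 3
    - x 4 * y 4 - x 5 * y 5 - x 6 * y 6 - x 7 * y 7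

def nb (y : Fin 8 → ℝ) : ℝ := y 4 ^ 2 + y 5 ^ 2 + y 6 ^ 2 + y 7 ^ 2

def k0 (y : Fin 8 → ℝ) : Fin 7 → ℝ :=
  ![y 4 ^ 2 + y 5 ^ 2 + y 6 ^ 2 + y 7 ^ 2,
    0,
    0,
    y 4 * y 1 - y 7 * y 0 - y 6 * y 3 + y 5 * y 2,
    y 5 * y 1 - y 6 * y 0 + y 7 * y 3 - y 4 * y 2,
    y 6 * y 1 + y 5 * y 0 + y 4 * y 3 + y 7 * y 2,
    y 7 * y 1 + y 4 * y 0 - y 5 * y 3 - y 6 * y 2]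

def k1 (y : Fin 8 → ℝ) : Fin 7 → ℝ :=
  ![0,
    y 4 ^ 2 + y 5 ^ 2 + y 6 ^ 2 + y 7 ^ 2,
    0,
    y 4 * y 2 + y 7 * y 3 - y 6 * y 0 - y 5 * y 1,
    y 5 * y 2 + y 6 * y 3 + y 7 * y 0 + y 4 * y 1,
    y 6 * y 2 - y 5 * y 3 + y 4 * y 0 - y 7 * y 1,
    y 7 * y 2 - y 4 * y 3 - y 5 * y 0 + y 6 * y 1]

def k2 (y : Fin 8 → ℝ) : Fin 7 → ℝ :=
  ![0,
    0,
    y 4 ^ 2 + y 5 ^ 2 + y 6 ^ 2 + y 7 ^ 2,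
    y 4 * y 3 - y 7 * y 2 + y 6 * y 1 - y 5 * y 0,
    y 5 * y 3 - y 6 * y 2 - y 7 * y 1 + y 4 * y 0,
    y 6 * y 3 + y 5 * y 2 - y 4 * y 1 - y 7 * y 0,
    y 7 * y 3 + y 4 * y 2 + y 5 * y 1 + y 6 * y 0]

def uu (y : Fin 8 → ℝ) : Fin 7 → ℝ :=
  ![0, 0, 0, y 4 * y 0 + y 5 * y 3 + y 6 * y 2 + y 7 * y 1,
    - y 4 * y 3 + y 5 * y 0 + y 6 * y 1 - y 7 * y 2,
    - y 4 * y 2 - y 5 * y 1 + y 6 * y 0 + y 7 * y 3,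
    - y 4 * y 1 + y 5 * y 2 - y 6 * y 3 + y 7 * y 0]

theorem Jv_mulVec (p : Fin 7 → ℝ) (y : Fin 8 → ℝ) : Jv p *ᵥ y = act p y := by
  simp only [Jv, Fin.sum_univ_seven, Matrix.add_mulVec, Matrix.smul_mulVec]
  ext i
  fin_cases i <;>
    simp [_root_.J, J1, J2, J3, J4, J5, J6, J7, act, Matrix.mulVec, dotProduct, Fin.sum_univ_eight] <;> ring

theorem act_clifford (p q : Fin 7 → ℝ) (y : Fin 8 → ℝ) :
    act p (act q y) + act q (act p y) = (-2 * ip p q) • y := by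
  ext i
  fin_cases i <;> simp [act, ip] <;> ring

theorem act_add (p q : Fin 7 → ℝ) (y : Fin 8 → ℝ) : act (p + q) y = act p y + act q y := by
  simp only [← Jv_mulVec, Jv, Pi.add_apply, add_smul, Finset.sum_add_distrib, Matrix.add_mulVec]

theorem act_smul (c : ℝ) (p : Fin 7 → ℝ) (y : Fin 8 → ℝ) : act (c • p) y = c • act p y := by
  simp only [← Jv_mulVec, Jv, Pi.smul_apply, smul_assoc, ← Finset.smul_sum, Matrix.smul_mulVec]

theorem act_vsmul (c : ℝ) (p : Fin 7 → ℝ) (y : Fin 8 → ℝ) : act p (c • y) = c • act p y := by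
  simp only [← Jv_mulVec, Matrix.mulVec_smul]

theorem act_zero (p : Fin 7 → ℝ) : act p 0 = 0 := by
  simp only [← Jv_mulVec, Matrix.mulVec_zero]

theorem Jv_clifford (p q : Fin 7 → ℝ) :
    Jv p * Jv q + Jv q * Jv p = (-2 * ip p q) • (1 : Matrix (Fin 8) (Fin 8) ℝ) := by
  apply Matrix.mulVec_injective
  funext y
  simp only [Matrix.add_mulVec, ← Matrix.mulVec_mulVec, Jv_mulVec, act_clifford,
    Matrix.smul_mulVec, Matrix.one_mulVec]

theorem gg_skew (p : Fin 7 → ℝ) (x y : Fin 8 → ℝ) : gg (act p x) y = - gg x (act p y) := by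
  simp [act, gg]; ring

theorem gg_act (p q : Fin 7 → ℝ) (y : Fin 8 → ℝ) :
    gg (act p y) (act q y) = ip p q * gg y y := by
  simp [act, gg, ip]; ring

def dual (y x : Fin 8 → ℝ) : Fin 7 → ℝ :=
  ![gg (act ![1,0,0,0,0,0,0] y) x, gg (act ![0,1,0,0,0,0,0] y) x, gg (act ![0,0,1,0,0,0,0] y) x,
    -gg (act ![0,0,0,1,0,0,0] y) x, -gg (act ![0,0,0,0,1,0,0] y) x,
    -gg (act ![0,0,0,0,0,1,0] y) x, -gg (act ![0,0,0,0,0,0,1] y) x]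

theorem ip_dual (z : Fin 7 → ℝ) (y x : Fin 8 → ℝ) : ip z (dual y x) = gg (act z y) x := by
  simp [act, gg, ip, dual]; ring

theorem act_dual (y x : Fin 8 → ℝ) : act (dual y x) y + gg y x • y = gg y y • x := by
  ext i
  fin_cases i <;> simp [act, gg, dual] <;> ring

theorem act_uu (y : Fin 8 → ℝ) (H : gg y y = 0) : act (uu y) y = nb y • y := by
  simp only [gg] at H
  ext i
  fin_cases i <;> simp [act, uu, nb]
  · linear_combination (0) * H
  · linear_combination (0) * H
  · linear_combination (0) * H
  · linear_combination (0) * H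
  · linear_combination (y 4) * H
  · linear_combination (y 5) * H
  · linear_combination (y 6) * H
  · linear_combination (y 7) * H

theorem act_k0 (y : Fin 8 → ℝ) (H : gg y y = 0) : act (k0 y) y = 0 := by
  simp only [gg] at H
  ext i
  fin_cases i <;> simp [act, k0]
  · linear_combination (0) * H
  · linear_combination (0) * H
  · linear_combination (0) * H
  · linear_combination (0) * H
  · linear_combination (-(y 7)) * H
  · linear_combination (-(y 6)) * H
  · linear_combination (-(-y 5)) * H
  · linear_combination (-(-y 4)) * H

theorem act_k1 (y : Fin 8 → ℝ) (H : gg y y = 0) : act (k1 y) y = 0 := by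
  simp only [gg] at H
  ext i
  fin_cases i <;> simp [act, k1]
  · linear_combination (0) * H
  · linear_combination (0) * H
  · linear_combination (0) * H
  · linear_combination (0) * H
  · linear_combination (-(y 6)) * H
  · linear_combination (-(-y 7)) * H
  · linear_combination (-(-y 4)) * H
  · linear_combination (-(y 5)) * H

theorem act_k2 (y : Fin 8 → ℝ) (H : gg y y = 0) : act (k2 y) y = 0 := by
  simp only [gg] at H
  ext i
  fin_cases i <;> simp [act, k2]
  · linear_combination (0) * H
  · linear_combination (0) * H
  · linear_combination (0) * H
  · linear_combination (0) * H
  · linear_combination (-(y 5)) * H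
  · linear_combination (-(-y 4)) * H
  · linear_combination (-(y 7)) * H
  · linear_combination (-(-y 6)) * H

theorem parallel (y : Fin 8 → ℝ) (z : Fin 7 → ℝ) (H : gg y y = 0)
    (h0 : ip z (k0 y) = 0) (h1 : ip z (k1 y) = 0) (h2 : ip z (k2 y) = 0) :
    nb y • act z y = (-ip z (uu y)) • y := by
  simp [ip, k0, k1, k2] at h0 h1 h2
  simp only [gg] at H
  ext i
  fin_cases i <;> simp [act, uu, nb, ip]
  · linear_combination (-y 1) * h0 + (-y 2) * h1 + (-y 3) * h2 - (z 3 * (y 4) + z 4 * (y 5) + z 5 * (y 6) + z 6 * (y 7)) * H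
  · linear_combination (y 0) * h0 + (-y 3) * h1 + (y 2) * h2 - (z 3 * (y 7) + z 4 * (y 6) + z 5 * (-y 5) + z 6 * (-y 4)) * H
  · linear_combination (y 3) * h0 + (y 0) * h1 + (-y 1) * h2 - (z 3 * (y 6) + z 4 * (-y 7) + z 5 * (-y 4) + z 6 * (y 5)) * H
  · linear_combination (-y 2) * h0 + (y 1) * h1 + (y 0) * h2 - (z 3 * (y 5) + z 4 * (-y 4) + z 5 * (y 7) + z 6 * (-y 6)) * H
  · linear_combination (y 7) * h0 + (y 6) * h1 + (y 5) * h2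
  · linear_combination (y 6) * h0 + (-y 7) * h1 + (-y 4) * h2
  · linear_combination (-y 5) * h0 + (-y 4) * h1 + (y 7) * h2
  · linear_combination (-y 4) * h0 + (y 5) * h1 + (-y 6) * h2

theorem bracket_mem (p q : Fin 7 → ℝ) : Jv p * Jv q - Jv q * Jv p ∈ NN := by
  have hb : ∀ i j : Fin 7, J i * J j - J j * J i ∈ NN := by
    intro i j
    rcases lt_trichotomy i j with h | h | h
    · exact Submodule.subset_span ⟨i, j, h, rfl⟩
    · subst h; simp
    · rw [← neg_sub]
      exact NN.neg_mem (Submodule.subset_span ⟨j, i, h, rfl⟩)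
  have : Jv p * Jv q - Jv q * Jv p
      = ∑ i, ∑ j, (p i * q j) • (J i * J j - J j * J i) := by
    simp only [Jv, Finset.sum_mul_sum, smul_sub, Finset.sum_sub_distrib]
    congr 1
    · simp [smul_smul, mul_comm]
    · rw [Finset.sum_comm]
      simp [smul_smul, mul_comm]
  rw [this]
  exact NN.sum_mem fun i _ => NN.sum_mem fun j _ => NN.smul_mem _ (hb i j)

theorem wedge (c : ℝ) (p q z : Fin 7 → ℝ) (y : Fin 8 → ℝ) (hp : ip p z = 0) (hq : ip q z = 0)
    (h : c • (act p (act q y) - act q (act p y)) = act z y) :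
    ∃ B ∈ NN, B * Jv z - Jv z * B = 0 ∧ B.mulVec y = (Jv z).mulVec y := by
  refine ⟨c • (Jv p * Jv q - Jv q * Jv p), NN.smul_mem _ (bracket_mem p q), ?_, ?_⟩
  · have e1 := Jv_clifford p z
    have e2 := Jv_clifford q z
    rw [hp, mul_zero, zero_smul] at e1
    rw [hq, mul_zero, zero_smul] at e2
    have e1' := eq_neg_of_add_eq_zero_left e1
    have e2' := eq_neg_of_add_eq_zero_left e2
    have a1 : Jv p * Jv q * Jv z = Jv z * (Jv p * Jv q) := by
      rw [mul_assoc, e2', mul_neg, ← mul_assoc, e1', neg_mul, neg_neg, mul_assoc]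
    have a2 : Jv q * Jv p * Jv z = Jv z * (Jv q * Jv p) := by
      rw [mul_assoc, e1', mul_neg, ← mul_assoc, e2', neg_mul, neg_neg, mul_assoc]
    rw [smul_mul_assoc, mul_smul_comm, sub_mul, mul_sub, a1, a2, sub_self]
  · rw [Matrix.smul_mulVec, Matrix.sub_mulVec, ← Matrix.mulVec_mulVec, ← Matrix.mulVec_mulVec]
    simp only [Jv_mulVec]
    exact h

theorem wedge' (p q z : Fin 7 → ℝ) (y : Fin 8 → ℝ) (hp : ip p z = 0) (hq : ip q z = 0)
    (hpq : ip p q = 0) (h : act p (act q y) = act z y) :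
    ∃ B ∈ NN, B * Jv z - Jv z * B = 0 ∧ B.mulVec y = (Jv z).mulVec y := by
  apply wedge (1 / 2) p q z y hp hq
  have e := act_clifford p q y
  rw [hpq, mul_zero, zero_smul] at e
  rw [← neg_eq_of_add_eq_zero_right e, h, sub_neg_eq_add, ← two_smul ℝ, smul_smul]
  norm_num

theorem ip_comm (p q : Fin 7 → ℝ) : ip p q = ip q p := by simp only [ip]; ring
theorem ip_add (p q r : Fin 7 → ℝ) : ip (p + q) r = ip p r + ip q r := by
  simp only [ip, Pi.add_apply]; ring
theorem ip_smul (c : ℝ) (p r : Fin 7 → ℝ) : ip (c • p) r = c * ip p r := by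
  simp only [ip, Pi.smul_apply, smul_eq_mul]; ring
theorem gg_smul (c : ℝ) (p r : Fin 8 → ℝ) : gg p (c • r) = c * gg p r := by
  simp only [gg, Pi.smul_apply, smul_eq_mul]; ring
theorem gg_comm (p r : Fin 8 → ℝ) : gg p r = gg r p := by
  simp only [gg]; ring

theorem exists_perp (z : Fin 7 → ℝ) : ∃ p, ip p z = 0 ∧ ip p p ≠ 0 := by
  by_cases h : z 0 ^ 2 + z 1 ^ 2 = 0
  · have h0 : z 0 = 0 := by nlinarith [sq_nonneg (z 0), sq_nonneg (z 1)]
    exact ⟨![1,0,0,0,0,0,0], by simp [ip, h0], by simp [ip]⟩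
  · refine ⟨![z 1, -z 0,0,0,0,0,0], by simp [ip]; ring, ?_⟩
    intro h'
    apply h
    simp [ip] at h'
    linarith

theorem act_self (p : Fin 7 → ℝ) (y : Fin 8 → ℝ) : act p (act p y) = (-ip p p) • y := by
  have := act_clifford p p y
  rw [← two_smul ℝ] at this
  have h2 : (-2 * ip p p) • y = (2 : ℝ) • ((-ip p p) • y) := by rw [smul_smul]; congr 1; ring
  rw [h2] at this
  exact smul_right_injective _ (two_ne_zero) this

theorem nonnull (z : Fin 7 → ℝ) (y : Fin 8 → ℝ) (hy : gg y y ≠ 0) :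
    ∃ B ∈ NN, B * Jv z - Jv z * B = 0 ∧ B.mulVec y = (Jv z).mulVec y := by
  obtain ⟨p, hp, hn⟩ := exists_perp z
  set x : Fin 8 → ℝ := act p (act z y) with hx
  have sk : ∀ (q : Fin 7 → ℝ) (w : Fin 8 → ℝ), gg w (act q w) = 0 := by
    intro q w
    have h1 := gg_skew q w w
    rw [gg_comm] at h1
    linarith
  have g1 : gg y x = 0 := by
    have h1 := gg_skew p y (act z y)
    rw [gg_act, hp] at h1
    linarith
  have g2 : gg (act p y) x = 0 := by
    rw [gg_skew, hx, act_self, gg_smul, sk]; simp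
  have g3 : gg (act z y) x = 0 := sk _ _
  have e := act_dual y x
  rw [g1, zero_smul, add_zero] at e
  refine wedge' p ((-(1 / (ip p p * gg y y))) • dual y x) z y hp ?_ ?_ ?_
  · rw [ip_smul, ip_comm (dual y x), ip_dual, g3, mul_zero]
  · rw [ip_comm, ip_smul, ip_comm (dual y x), ip_dual, g2, mul_zero]
  · rw [act_smul, e, smul_smul, act_vsmul, hx, act_self, smul_smul]
    have : -(1 / (ip p p * gg y y)) * gg y y * -ip p p = 1 := by field_simp
    rw [this, one_smul]

theorem case1 (z k : Fin 7 → ℝ) (y : Fin 8 → ℝ) (H : gg y y = 0) (hy : y ≠ 0) (hr : nb y ≠ 0)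
    (hk : act k y = 0) (hz : ip z k ≠ 0) :
    ∃ B ∈ NN, B * Jv z - Jv z * B = 0 ∧ B.mulVec y = (Jv z).mulVec y := by
  obtain ⟨u, hu⟩ : ∃ u, act u y = y := by
    refine ⟨(nb y)⁻¹ • uu y, ?_⟩
    rw [act_smul, act_uu y H, smul_smul, inv_mul_cancel₀ hr, one_smul]
  have kk : ip k k = 0 := by
    have h := act_self k y
    rw [hk, act_zero] at h
    rcases smul_eq_zero.1 h.symm with h | h
    · linarith
    · exact absurd h hy
  have ku : ip k u = 0 := by
    have h := act_clifford k u y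
    rw [hk, hu, act_zero, hk, add_zero] at h
    rcases smul_eq_zero.1 h.symm with h | h
    · linarith
    · exact absurd h hy
  have hz' : ip k z ≠ 0 := by rwa [ip_comm]
  have h1 : ip (z + (-(ip z z / ip k z)) • k) z = 0 := by
    rw [ip_add, ip_smul]; field_simp; ring
  have h2 : ip (u + (-(ip u z / ip k z)) • k) z = 0 := by
    rw [ip_add, ip_smul]; field_simp; ring
  refine wedge' (z + (-(ip z z / ip k z)) • k) (u + (-(ip u z / ip k z)) • k) z y h1 h2 ?_ ?_
  · have h3 : ip k (u + (-(ip u z / ip k z)) • k) = 0 := by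
      rw [ip_comm, ip_add, ip_smul, ip_comm u k, ku, kk]; ring
    rw [ip_add, ip_smul, h3, ip_comm, h2]; ring
  · simp only [act_add, act_smul, hk, hu, smul_zero, add_zero]

theorem nullcase (z : Fin 7 → ℝ) (y : Fin 8 → ℝ) (H : gg y y = 0) (hy : y ≠ 0) :
    ∃ B ∈ NN, B * Jv z - Jv z * B = 0 ∧ B.mulVec y = (Jv z).mulVec y := by
  have hr : nb y ≠ 0 := by
    intro h
    apply hy
    simp only [nb] at h
    simp only [gg] at H
    ext i
    fin_cases i <;> simp <;>
      nlinarith [sq_nonneg (y 0), sq_nonneg (y 1), sq_nonneg (y 2), sq_nonneg (y 3),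
        sq_nonneg (y 4), sq_nonneg (y 5), sq_nonneg (y 6), sq_nonneg (y 7)]
  by_cases h0 : ip z (k0 y) = 0
  swap
  · exact case1 z _ y H hy hr (act_k0 y H) h0
  by_cases h1 : ip z (k1 y) = 0
  swap
  · exact case1 z _ y H hy hr (act_k1 y H) h1
  by_cases h2 : ip z (k2 y) = 0
  swap
  · exact case1 z _ y H hy hr (act_k2 y H) h2
  have hpar := parallel y z H h0 h1 h2
  obtain ⟨l, hl⟩ : ∃ l : ℝ, act z y = l • y := by
    refine ⟨(nb y)⁻¹ * (-ip z (uu y)), ?_⟩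
    rw [← smul_smul, ← hpar, smul_smul, inv_mul_cancel₀ hr, one_smul]
  by_cases hl0 : l = 0
  · refine ⟨0, NN.zero_mem, by simp, ?_⟩
    rw [Jv_mulVec, hl, hl0]; simp
  have hzz : ip z z ≠ 0 := by
    intro h
    have e := act_self z y
    rw [h, hl, act_vsmul, hl, smul_smul, neg_zero, zero_smul] at e
    rcases smul_eq_zero.1 e with h | h
    · exact hl0 (by simpa using h)
    · exact hy h
  set e1 : Fin 7 → ℝ := ![1,0,0,0,0,0,0] with he1
  set q : Fin 7 → ℝ := e1 + (-(ip e1 z / ip z z)) • z with hq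
  have hqz : ip q z = 0 := by
    rw [hq, ip_add, ip_smul]; field_simp; ring
  have hkq : ip (k0 y) q = nb y := by
    rw [ip_comm, hq, ip_add, ip_smul, h0]
    simp [he1, ip, k0, nb]
  refine wedge (-l / (2 * nb y)) (k0 y) q z y (by rw [ip_comm]; exact h0) hqz ?_
  have e := act_clifford (k0 y) q y
  rw [act_k0 y H, act_zero, add_zero, hkq] at e
  rw [act_k0 y H, act_zero, sub_zero, e, hl, smul_smul]
  congr 1
  field_simp

/-- Strong transitive normalizer condition for `V = span{J₁,…,J₇}`: for every
`Z ∈ V` and every `Y ∈ ℝ⁸` there is `B ∈ N = span{[Jᵢ,Jⱼ]}` with `[B, Z] = 0`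
and `B·Y = Z·Y`.  This is the algebraic content of the fact that the pseudo
H-type nilmanifold `N_{3,4}` is geodesic orbit. -/
theorem statement0 :
    ∀ Z ∈ Submodule.span ℝ (Set.range J), ∀ Y : Fin 8 → ℝ,
      ∃ B ∈ NN, B * Z - Z * B = 0 ∧ B.mulVec Y = Z.mulVec Y := by
  intro Z hZ Y
  obtain ⟨z, rfl⟩ := (Submodule.mem_span_range_iff_exists_fun ℝ).1 hZ
  change ∃ B ∈ NN, B * Jv z - Jv z * B = 0 ∧ B.mulVec Y = (Jv z).mulVec Y
  by_cases hy : gg Y Y = 0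
  · by_cases h : Y = 0
    · subst h
      exact ⟨0, NN.zero_mem, by simp, by simp⟩
    · exact nullcase z Y hy h
  · exact nonnull z Y hy

end
end

section
/- For every vector Y ∈ ℝ⁸ there exists a matrix B ∈ N = span_ℝ{[Jᵢ,Jⱼ] : 1 ≤ i < j ≤ 7} such that [B, J₁] = 0 and B·Y = J₁·Y. -/
open Matrix

noncomputable section

lemma aux_zero {x y z w : ℝ} (h : x ^ 2 + y ^ 2 + z ^ 2 + w ^ 2 = 0) :
    x = 0 ∧ y = 0 ∧ z = 0 ∧ w = 0 := by
  refine ⟨?_, ?_, ?_, ?_⟩ <;> nlinarith [sq_nonneg x, sq_nonneg y, sq_nonneg z, sq_nonneg w]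

lemma aux_top (x y z w : ℝ) : ∃ a d e : ℝ,
    -e * y - d * z - a * w = -y ∧ e * x - a * z + d * w = x ∧
    d * x + a * y - e * w = w ∧ a * x - d * y + e * z = -z := by
  by_cases h : x ^ 2 + y ^ 2 + z ^ 2 + w ^ 2 = 0
  · obtain ⟨rfl, rfl, rfl, rfl⟩ := aux_zero h
    exact ⟨0, 0, 0, by simp⟩
  · refine ⟨2 * (y * w - x * z) / (x ^ 2 + y ^ 2 + z ^ 2 + w ^ 2),
      2 * (y * z + x * w) / (x ^ 2 + y ^ 2 + z ^ 2 + w ^ 2),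
      (x ^ 2 + y ^ 2 - z ^ 2 - w ^ 2) / (x ^ 2 + y ^ 2 + z ^ 2 + w ^ 2), ?_, ?_, ?_, ?_⟩ <;>
    · field_simp
      ring

lemma aux_bot (x y z w : ℝ) : ∃ b c f : ℝ,
    b * y + c * z + f * w = w ∧ -b * x - f * z + c * w = z ∧
    -c * x + f * y - b * w = -y ∧ -f * x - c * y + b * z = -x := by
  by_cases h : x ^ 2 + y ^ 2 + z ^ 2 + w ^ 2 = 0
  · obtain ⟨rfl, rfl, rfl, rfl⟩ := aux_zero h
    exact ⟨0, 0, 0, by simp⟩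
  · refine ⟨2 * (y * w - x * z) / (x ^ 2 + y ^ 2 + z ^ 2 + w ^ 2),
      2 * (z * w + x * y) / (x ^ 2 + y ^ 2 + z ^ 2 + w ^ 2),
      (x ^ 2 + w ^ 2 - y ^ 2 - z ^ 2) / (x ^ 2 + y ^ 2 + z ^ 2 + w ^ 2), ?_, ?_, ?_, ?_⟩ <;>
    · field_simp
      ring

/-- The matrix of the `so(4)` part. -/
def BB (a b c d e f : ℝ) : Matrix (Fin 8) (Fin 8) ℝ :=
  !![0,-e,-d,-a,0,0,0,0;
     e,0,-a,d,0,0,0,0;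
     d,a,0,-e,0,0,0,0;
     a,-d,e,0,0,0,0,0;
     0,0,0,0,0,b,c,f;
     0,0,0,0,-b,0,-f,c;
     0,0,0,0,-c,f,0,-b;
     0,0,0,0,-f,-c,b,0]

lemma comm_mem (i j : Fin 7) (h : i < j) : J i * J j - J j * J i ∈ NN :=
  Submodule.subset_span ⟨i, j, h, rfl⟩

set_option maxHeartbeats 4000000 in
lemma BB_eq (a b c d e f : ℝ) : BB a b c d e f =
    ((a + b) / 4) • (J4 * J5 - J5 * J4) + ((a - b) / 4) • (J6 * J7 - J7 * J6) +
    ((c + d) / 4) • (J4 * J6 - J6 * J4) + ((c - d) / 4) • (J5 * J7 - J7 * J5) +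
    ((e + f) / 4) • (J4 * J7 - J7 * J4) + ((e - f) / 4) • (J5 * J6 - J6 * J5) := by
  ext i j
  simp only [Matrix.add_apply, Matrix.smul_apply, Matrix.sub_apply, Matrix.mul_apply,
    Fin.sum_univ_eight, smul_eq_mul]
  fin_cases i <;> fin_cases j <;>
    simp [BB, J4, J5, J6, J7] <;> ring

lemma BB_mem (a b c d e f : ℝ) : BB a b c d e f ∈ NN := by
  rw [BB_eq]
  have h (i j : Fin 7) (r : ℝ) (h : i < j) : r • (J i * J j - J j * J i) ∈ NN :=
    NN.smul_mem r (comm_mem i j h)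
  exact NN.add_mem (NN.add_mem (NN.add_mem (NN.add_mem (NN.add_mem
    (h 3 4 _ (by decide)) (h 5 6 _ (by decide))) (h 3 5 _ (by decide)))
    (h 4 6 _ (by decide))) (h 3 6 _ (by decide))) (h 4 5 _ (by decide))

set_option maxHeartbeats 4000000 in
lemma BB_comm (a b c d e f : ℝ) : BB a b c d e f * J1 - J1 * BB a b c d e f = 0 := by
  ext i j
  simp only [Matrix.sub_apply, Matrix.mul_apply, Fin.sum_univ_eight]
  fin_cases i <;> fin_cases j <;> simp [BB, J1]

/-- For every `Y ∈ ℝ⁸` there is `B ∈ N = span{[Jᵢ,Jⱼ] : 1 ≤ i < j ≤ 7}` with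
`[B, J₁] = 0` and `B·Y = J₁·Y`. -/
theorem statement1 :
    ∀ Y : Fin 8 → ℝ,
      ∃ B ∈ NN, B * J1 - J1 * B = 0 ∧ B.mulVec Y = J1.mulVec Y := by
  intro Y
  obtain ⟨a, d, e, h0, h1, h2, h3⟩ := aux_top (Y 0) (Y 1) (Y 2) (Y 3)
  obtain ⟨b, c, f, h4, h5, h6, h7⟩ := aux_bot (Y 4) (Y 5) (Y 6) (Y 7)
  refine ⟨BB a b c d e f, BB_mem a b c d e f, BB_comm a b c d e f, ?_⟩
  ext i
  fin_cases i <;>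
    simp [BB, J1, Matrix.mulVec, dotProduct, Fin.sum_univ_eight] <;> linarith

end
end

section
/- For every vector Y ∈ ℝ⁸ there exists a matrix B ∈ N = span_ℝ{[Jᵢ,Jⱼ] : 1 ≤ i < j ≤ 7} such that [B, J₁ + J₄] = 0 and B·Y = (J₁ + J₄)·Y. -/
open Matrix

noncomputable section

set_option maxHeartbeats 1000000 in
theorem ZZ : (J1 + J4) * (J1 + J4) = 0 := by
  apply Matrix.mulVec_injective
  funext Y
  simp only [← Matrix.mulVec_mulVec, Matrix.neg_mulVec, Matrix.zero_mulVec]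
  ext i
  fin_cases i <;> simp [J1, J4, Matrix.mulVec, dotProduct, Fin.sum_univ_succ] <;> try ring

set_option maxHeartbeats 1000000 in
theorem anti15 : J5 * J1 = - (J1 * J5) := by
  apply Matrix.mulVec_injective
  funext Y
  simp only [← Matrix.mulVec_mulVec, Matrix.neg_mulVec, Matrix.zero_mulVec]
  ext i
  fin_cases i <;> simp [J1, J5, Matrix.mulVec, dotProduct, Fin.sum_univ_succ] <;> try ring

set_option maxHeartbeats 1000000 in
theorem anti45 : J5 * J4 = - (J4 * J5) := by
  apply Matrix.mulVec_injective
  funext Y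
  simp only [← Matrix.mulVec_mulVec, Matrix.neg_mulVec, Matrix.zero_mulVec]
  ext i
  fin_cases i <;> simp [J4, J5, Matrix.mulVec, dotProduct, Fin.sum_univ_succ] <;> try ring

theorem mem5 : J5 * (J1 + J4) ∈ NN := by
  have h1 : J1 * J5 - J5 * J1 ∈ NN := Submodule.subset_span ⟨0, 4, by decide, rfl⟩
  have h4 : J4 * J5 - J5 * J4 ∈ NN := Submodule.subset_span ⟨3, 4, by decide, rfl⟩
  have h := NN.smul_mem (-(1/2) : ℝ) (NN.add_mem h1 h4)
  convert h using 1
  rw [mul_add, anti15, anti45]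
  module

theorem comm5 : J5 * (J1 + J4) * (J1 + J4) - (J1 + J4) * (J5 * (J1 + J4)) = 0 := by
  have h : J5 * (J1 + J4) = - ((J1 + J4) * J5) := by
    rw [mul_add, add_mul, anti15, anti45]; abel
  rw [mul_assoc, ZZ, h, mul_neg, ← mul_assoc, ZZ]
  simp

set_option maxHeartbeats 1000000 in
theorem anti16 : J6 * J1 = - (J1 * J6) := by
  apply Matrix.mulVec_injective
  funext Y
  simp only [← Matrix.mulVec_mulVec, Matrix.neg_mulVec, Matrix.zero_mulVec]
  ext i
  fin_cases i <;> simp [J1, J6, Matrix.mulVec, dotProduct, Fin.sum_univ_succ] <;> try ring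

set_option maxHeartbeats 1000000 in
theorem anti46 : J6 * J4 = - (J4 * J6) := by
  apply Matrix.mulVec_injective
  funext Y
  simp only [← Matrix.mulVec_mulVec, Matrix.neg_mulVec, Matrix.zero_mulVec]
  ext i
  fin_cases i <;> simp [J4, J6, Matrix.mulVec, dotProduct, Fin.sum_univ_succ] <;> try ring

theorem mem6 : J6 * (J1 + J4) ∈ NN := by
  have h1 : J1 * J6 - J6 * J1 ∈ NN := Submodule.subset_span ⟨0, 5, by decide, rfl⟩
  have h4 : J4 * J6 - J6 * J4 ∈ NN := Submodule.subset_span ⟨3, 5, by decide, rfl⟩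
  have h := NN.smul_mem (-(1/2) : ℝ) (NN.add_mem h1 h4)
  convert h using 1
  rw [mul_add, anti16, anti46]
  module

theorem comm6 : J6 * (J1 + J4) * (J1 + J4) - (J1 + J4) * (J6 * (J1 + J4)) = 0 := by
  have h : J6 * (J1 + J4) = - ((J1 + J4) * J6) := by
    rw [mul_add, add_mul, anti16, anti46]; abel
  rw [mul_assoc, ZZ, h, mul_neg, ← mul_assoc, ZZ]
  simp

set_option maxHeartbeats 1000000 in
theorem anti17 : J7 * J1 = - (J1 * J7) := by
  apply Matrix.mulVec_injective
  funext Y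
  simp only [← Matrix.mulVec_mulVec, Matrix.neg_mulVec, Matrix.zero_mulVec]
  ext i
  fin_cases i <;> simp [J1, J7] <;> try ring

set_option maxHeartbeats 1000000 in
theorem anti47 : J7 * J4 = - (J4 * J7) := by
  apply Matrix.mulVec_injective
  funext Y
  simp only [← Matrix.mulVec_mulVec, Matrix.neg_mulVec, Matrix.zero_mulVec]
  ext i
  fin_cases i <;> simp [J4, J7] <;> try ring

theorem mem7 : J7 * (J1 + J4) ∈ NN := by
  have h1 : J1 * J7 - J7 * J1 ∈ NN := Submodule.subset_span ⟨0, 6, by decide, rfl⟩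
  have h4 : J4 * J7 - J7 * J4 ∈ NN := Submodule.subset_span ⟨3, 6, by decide, rfl⟩
  have h := NN.smul_mem (-(1/2) : ℝ) (NN.add_mem h1 h4)
  convert h using 1
  rw [mul_add, anti17, anti47]
  module

theorem comm7 : J7 * (J1 + J4) * (J1 + J4) - (J1 + J4) * (J7 * (J1 + J4)) = 0 := by
  have h : J7 * (J1 + J4) = - ((J1 + J4) * J7) := by
    rw [mul_add, add_mul, anti17, anti47]; abel
  rw [mul_assoc, ZZ, h, mul_neg, ← mul_assoc, ZZ]
  simp

theorem Zvec (Y : Fin 8 → ℝ) : ∃ a b c d : ℝ,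
    (J1 + J4).mulVec Y = ![a, b, c, d, b, c, -d, -a] := by
  refine ⟨-Y 1 + Y 4, Y 0 + Y 7, Y 3 + Y 6, -Y 2 + Y 5, ?_⟩
  ext i
  fin_cases i <;> simp [J1, J4, Matrix.mulVec, dotProduct, Fin.sum_univ_succ] <;> ring

theorem key (a b c d : ℝ) : ∃ p q r : ℝ,
    p • J5.mulVec ![a, b, c, d, b, c, -d, -a] + q • J6.mulVec ![a, b, c, d, b, c, -d, -a]
      + r • J7.mulVec ![a, b, c, d, b, c, -d, -a] = ![a, b, c, d, b, c, -d, -a] := by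
  by_cases hn : a^2 + b^2 + c^2 + d^2 = 0
  · have ha : a = 0 := by nlinarith [sq_nonneg a, sq_nonneg b, sq_nonneg c, sq_nonneg d]
    have hb : b = 0 := by nlinarith [sq_nonneg a, sq_nonneg b, sq_nonneg c, sq_nonneg d]
    have hc : c = 0 := by nlinarith [sq_nonneg a, sq_nonneg b, sq_nonneg c, sq_nonneg d]
    have hd : d = 0 := by nlinarith [sq_nonneg a, sq_nonneg b, sq_nonneg c, sq_nonneg d]
    subst ha hb hc hd
    refine ⟨0, 0, 0, ?_⟩
    ext i
    fin_cases i <;> simp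
  · refine ⟨2*(a*c-b*d)/(a^2 + b^2 + c^2 + d^2), -2*(a*d+b*c)/(a^2 + b^2 + c^2 + d^2),
      (-a^2-b^2+c^2+d^2)/(a^2 + b^2 + c^2 + d^2), ?_⟩
    ext i
    fin_cases i <;> simp [J5, J6, J7] <;>
      field_simp <;> ring

/-- For every `Y ∈ ℝ⁸` there is `B ∈ N = span{[Jᵢ,Jⱼ] : 1 ≤ i < j ≤ 7}` with
`[B, J₁ + J₄] = 0` and `B·Y = (J₁ + J₄)·Y`. -/
theorem statement3 :
    ∀ Y : Fin 8 → ℝ,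
      ∃ B ∈ NN, B * (J1 + J4) - (J1 + J4) * B = 0 ∧
        B.mulVec Y = (J1 + J4).mulVec Y := by
  intro Y
  obtain ⟨a, b, c, d, hY⟩ := Zvec Y
  obtain ⟨p, q, r, h⟩ := key a b c d
  refine ⟨p • (J5 * (J1 + J4)) + q • (J6 * (J1 + J4)) + r • (J7 * (J1 + J4)),
    NN.add_mem (NN.add_mem (NN.smul_mem _ mem5) (NN.smul_mem _ mem6)) (NN.smul_mem _ mem7),
    ?_, ?_⟩
  · have h5 := sub_eq_zero.1 comm5
    have h6 := sub_eq_zero.1 comm6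
    have h7 := sub_eq_zero.1 comm7
    rw [add_mul, add_mul, mul_add (J1 + J4), mul_add (J1 + J4)]
    simp only [Matrix.smul_mul, Matrix.mul_smul]
    rw [h5, h6, h7, sub_self]
  · simp only [Matrix.add_mulVec _ (r • _), Matrix.add_mulVec (p • _), Matrix.smul_mulVec,
      ← Matrix.mulVec_mulVec]
    rw [hY, h]

end
end

section
/- Let Y = (y₁,…,y₈) ∈ ℝ⁸ satisfy the eight equations: y₁y₈ − y₂y₅ − y₃y₆ + y₄y₇ = 0; y₁y₇ + y₂y₆ − y₃y₅ − y₄y₈ = 0; y₁y₄ + y₂y₃ − y₅y₆ − y₇y₈ = 0; y₁y₄ − y₂y₃ − y₅y₆ + y₇y₈ = 0; y₁y₃ − y₂y₄ − y₅y₇ + y₆y₈ = 0; y₁y₂ + y₃y₄ − y₅y₈ − y₆y₇ = 0; y₁² + y₂² − y₃² − y₄² − y₅² + y₆² + y₇² − y₈² = 0; y₁² − y₂² + y₃² − y₄² − y₅² + y₆² − y₇² + y₈² = 0. Then either (y₅,y₆,y₇,y₈) = (y₁,y₄,y₃,y₂) or (y₅,y₆,y₇,y₈) = (−y₁,−y₄,−y₃,−y₂).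 -/
/-- If two complex numbers `a + ib`, `c + id` have equal squares then they agree up to sign. -/
theorem aux_sq (a b c d : ℝ) (h : a*b = c*d) (h' : a^2 - b^2 = c^2 - d^2) :
    (c = a ∧ d = b) ∨ (c = -a ∧ d = -b) := by
  have e : ((c - a)^2 + (d - b)^2) * ((c + a)^2 + (d + b)^2) = 0 := by
    have : ((c - a)^2 + (d - b)^2) * ((c + a)^2 + (d + b)^2)
        = ((c^2 - d^2) - (a^2 - b^2))^2 + 4 * (c*d - a*b)^2 := by ring
    rw [this, h, h']; ring
  rcases mul_eq_zero.mp e with e | e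
  · left; constructor <;> nlinarith [sq_nonneg (c - a), sq_nonneg (d - b)]
  · right; constructor <;> nlinarith [sq_nonneg (c + a), sq_nonneg (d + b)]

/-- Two planar vectors satisfying the cross relations: one of them vanishes. -/
theorem aux_zero_s4 (a b c d : ℝ) (h : a*c + b*d = 0) (h' : a*d - b*c = 0) :
    (a = 0 ∧ b = 0) ∨ (c = 0 ∧ d = 0) := by
  have e : (a^2 + b^2) * (c^2 + d^2) = 0 := by
    have : (a^2 + b^2) * (c^2 + d^2) = (a*c + b*d)^2 + (a*d - b*c)^2 := by ring
    rw [this, h, h']; ring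
  rcases mul_eq_zero.mp e with e | e
  · left; constructor <;> nlinarith [sq_nonneg a, sq_nonneg b]
  · right; constructor <;> nlinarith [sq_nonneg c, sq_nonneg d]

/-- If `Y = (y₁,…,y₈) ∈ ℝ⁸` satisfies the eight quadratic equations below, then
either `(y₅,y₆,y₇,y₈) = (y₁,y₄,y₃,y₂)` or `(y₅,y₆,y₇,y₈) = (−y₁,−y₄,−y₃,−y₂)`. -/
theorem statement4 (y1 y2 y3 y4 y5 y6 y7 y8 : ℝ)
    (h1 : y1*y8 - y2*y5 - y3*y6 + y4*y7 = 0)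
    (h2 : y1*y7 + y2*y6 - y3*y5 - y4*y8 = 0)
    (h3 : y1*y4 + y2*y3 - y5*y6 - y7*y8 = 0)
    (h4 : y1*y4 - y2*y3 - y5*y6 + y7*y8 = 0)
    (h5 : y1*y3 - y2*y4 - y5*y7 + y6*y8 = 0)
    (h6 : y1*y2 + y3*y4 - y5*y8 - y6*y7 = 0)
    (h7 : y1^2 + y2^2 - y3^2 - y4^2 - y5^2 + y6^2 + y7^2 - y8^2 = 0)
    (h8 : y1^2 - y2^2 + y3^2 - y4^2 - y5^2 + y6^2 - y7^2 + y8^2 = 0) :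
    (y5 = y1 ∧ y6 = y4 ∧ y7 = y3 ∧ y8 = y2) ∨
    (y5 = -y1 ∧ y6 = -y4 ∧ y7 = -y3 ∧ y8 = -y2) := by
  rcases aux_sq y1 y4 y5 y6 (by linarith) (by linarith) with ⟨rfl, rfl⟩ | ⟨rfl, rfl⟩ <;>
  rcases aux_sq y2 y3 y8 y7 (by linarith) (by linarith) with ⟨rfl, rfl⟩ | ⟨rfl, rfl⟩
  · simp
  · rcases aux_zero_s4 y5 y6 y2 y3 (by linarith) (by linarith) with ⟨rfl, rfl⟩ | ⟨rfl, rfl⟩ <;> simp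
  · rcases aux_zero_s4 y1 y4 y8 y7 (by linarith) (by linarith) with ⟨rfl, rfl⟩ | ⟨rfl, rfl⟩ <;> simp
  · simp
end

section
/- Let n be a positive integer with n ≡ 0 (mod 4), let V be a real vector space, and let ε₁,…,ε_n ∈ {1, −1}. Suppose J₁,…,J_n are linear endomorphisms of V satisfying the Clifford relations J_iJ_j = −J_jJ_i for i ≠ j and J_i² = −ε_i·id. Let C = (c_{ij}) be a real n×n matrix that is skew-symmetric with respect to the form diag(ε₁,…,ε_n), i.e. ε_i c_{ij} + ε_j c_{ji} = 0 for all i, j. If a linear endomorphism A of V satisfies A∘J_i − J_i∘A = Σ_{j=1}^{n} c_{ji} J_j for every i = 1,…,n, then A commutes with the product J₁∘J₂∘⋯∘J_n, i.e. A∘(J₁⋯J_n) = (J₁⋯J_n)∘A. -/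
theorem aux_anti {n : ℕ} {R : Type*} [Ring R] (J : Fin n → R)
    (hanti : ∀ i j, i ≠ j → J i * J j = -(J j * J i)) (k : Fin n) (l : List (Fin n)) :
    J k * (l.map J).prod = (-1) ^ (l.length + l.count k) * ((l.map J).prod * J k) := by
  induction l with
  | nil => simp
  | cons a l ih =>
    rw [List.map_cons, List.prod_cons, List.length_cons, List.count_cons]
    have hc : J a * (-1) ^ (l.length + l.count k) = (-1) ^ (l.length + l.count k) * J a :=
      ((Commute.neg_one_right (J a)).pow_right _).eq
    by_cases h : a = k
    · subst h
      have e : l.length + 1 + (l.count a + if (a == a) = true then 1 else 0)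
        = l.length + l.count a + 2 := by simp; omega
      rw [e, pow_add, mul_assoc (J a), ih, ← mul_assoc, hc]
      simp [mul_assoc]
    · have e : l.length + 1 + (l.count k + if (a == k) = true then 1 else 0)
        = l.length + l.count k + 1 := by simp [h]; omega
      rw [e, ← mul_assoc, hanti k a (Ne.symm h), neg_mul, mul_assoc, ih, ← mul_assoc, hc]
      simp [pow_succ, mul_assoc]

/-- Let `n ≡ 0 (mod 4)`, let `J₁,…,J_n` be endomorphisms of a real vector space `V`
satisfying the Clifford relations `JᵢJⱼ = −JⱼJᵢ` (`i ≠ j`) and `Jᵢ² = −εᵢ·id` with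
`εᵢ = ±1`.  If `C` is skew-symmetric with respect to `diag(ε₁,…,ε_n)` and `A`
satisfies `A∘Jᵢ − Jᵢ∘A = Σⱼ cⱼᵢ Jⱼ` for every `i`, then `A` commutes with the
ordered product `J₁∘⋯∘J_n`. -/
theorem statement9 (n : ℕ) (hn : 0 < n) (hmod : n % 4 = 0)
    (V : Type*) [AddCommGroup V] [Module ℝ V]
    (ε : Fin n → ℝ) (hε : ∀ i, ε i = 1 ∨ ε i = -1)
    (J : Fin n → Module.End ℝ V)
    (hanti : ∀ i j, i ≠ j → J i * J j = -(J j * J i))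
    (hsq : ∀ i, J i * J i = -(ε i) • 1)
    (C : Matrix (Fin n) (Fin n) ℝ)
    (hC : ∀ i j, ε i * C i j + ε j * C j i = 0)
    (A : Module.End ℝ V)
    (hA : ∀ i, A * J i - J i * A = ∑ j, C j i • J j) :
    A * (List.ofFn J).prod = (List.ofFn J).prod * A := by
  have hω : (List.ofFn J).prod = ((List.finRange n).map J).prod := by
    rw [List.ofFn_eq_map]
  have hanti' : ∀ k, J k * (List.ofFn J).prod = -((List.ofFn J).prod * J k) := by
    intro k
    rw [hω, aux_anti J hanti k]
    have hodd : Odd ((List.finRange n).length + (List.finRange n).count k) := by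
      rw [List.length_finRange, List.count_eq_one_of_mem (List.nodup_finRange n)
        (List.mem_finRange k)]
      exact ⟨n / 2, by omega⟩
    rw [hodd.neg_one_pow, neg_one_mul]
  have hac : ∀ j k, J j * J k + J k * J j = if j = k then (-2 * ε k) • 1 else 0 := by
    intro j k
    split_ifs with h
    · subst h
      rw [hsq, ← add_smul]
      congr 1
      ring
    · rw [hanti j k h]; simp
  set B : Module.End ℝ V := ∑ i, ∑ j, (-(ε j * C i j) / 4) • (J i * J j) with hB
  have hb : ∀ i j, ε j * C i j = -(ε i * C j i) := by
    intro i j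
    have h := hC i j
    rcases hε i with h1 | h1 <;> rcases hε j with h2 | h2 <;> rw [h1, h2] at h ⊢ <;> linarith
  have hεε : ∀ k, ε k * ε k = 1 := by
    intro k
    rcases hε k with h1 | h1 <;> rw [h1] <;> norm_num
  have hBω : Commute B (List.ofFn J).prod := by
    rw [hB]
    refine Commute.sum_left _ _ _ fun i _ => Commute.sum_left _ _ _ fun j _ => ?_
    refine Commute.smul_left ?_ _
    show J i * J j * _ = _ * (J i * J j)
    rw [mul_assoc, hanti' j, mul_neg, ← mul_assoc, hanti' i, neg_mul, neg_neg, mul_assoc]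
  have hBJ : ∀ k, B * J k - J k * B = ∑ j, C j k • J j := by
    intro k
    have h1 : ∀ i j, J i * J j * J k - J k * (J i * J j)
        = (if j = k then (-2 * ε k) • J i else 0) - (if i = k then (-2 * ε k) • J j else 0) := by
      intro i j
      have e : J i * J j * J k - J k * (J i * J j)
        = J i * (J j * J k + J k * J j) - (J i * J k + J k * J i) * J j := by noncomm_ring
      rw [e, hac, hac]
      split_ifs <;> simp
    have h2 : B * J k - J k * B = ∑ i, ∑ j, (-(ε j * C i j) / 4) •
        ((if j = k then (-2 * ε k) • J i else 0) - (if i = k then (-2 * ε k) • J j else 0)) := by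
      simp only [← h1, hB, Finset.sum_mul, Finset.mul_sum, smul_sub, Finset.sum_sub_distrib,
        smul_mul_assoc, mul_smul_comm]
    rw [h2]
    simp only [smul_sub, Finset.sum_sub_distrib, smul_ite, smul_zero]
    rw [Finset.sum_comm (f := fun i j => if i = k then _ else _)]
    simp only [Finset.sum_ite_eq', Finset.mem_univ, if_true]
    rw [← Finset.sum_sub_distrib]
    refine Finset.sum_congr rfl fun i _ => ?_
    rw [smul_smul, smul_smul, ← sub_smul]
    congr 1
    rw [hb k i]
    linear_combination C i k * hεε k
  have hD : Commute (A - B) (List.ofFn J).prod := by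
    rw [hω]
    refine Commute.list_prod_right _ _ fun x hx => ?_
    obtain ⟨k, -, rfl⟩ := List.mem_map.1 hx
    show (A - B) * J k = J k * (A - B)
    rw [sub_mul, mul_sub, sub_eq_sub_iff_sub_eq_sub, hA, hBJ]
  have := hD.add_left hBω
  rw [sub_add_cancel] at this
  exact this.eq
end
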